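/- arXiv:2511.09191 — 3 statements merged into one kernel-verified Lean document; each statement's English description precedes it below -/
import Mathlib

section
/- Fix \tau \in [0,1). The function \phi_s(\cdot;\tau) is twice differentiable at its minimiser x_s := \sqrt{(2/\pi) \cdot (1+\tau)/(1-\tau)}, and \phi_s''(x_s;\tau) = 1 / \big( (2-\sqrt{2}) \sqrt{(2/\pi) \cdot (1+\tau)/(1-\tau)} \big). -/
open Real Set MeasureTheory Filter

/-- `Ψ_s(z;τ) = √((1+τ)/((1-τ)·2π)) · (2/√π) ∫_0^∞ log(1 - (1-z) e^{-t²}) dt`. -/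
noncomputable def PsiS (τ z : ℝ) : ℝ :=
  Real.sqrt ((1 + τ) / ((1 - τ) * (2 * Real.pi))) *
    ((2 / Real.sqrt Real.pi) *
      ∫ t in Set.Ioi (0 : ℝ), Real.log (1 - (1 - z) * Real.exp (-t ^ 2)))

/-- `φ_s(x;τ) = sup_{u ∈ ℝ} { (x/2) u - Ψ_s(e^u;τ) }`. -/
noncomputable def phiS (τ x : ℝ) : ℝ :=
  ⨆ u : ℝ, ((x / 2) * u - PsiS τ (Real.exp u))

/-- The Legendre transform of a convex `C²` function `F` is twice differentiable at any slope
`F' u₀` with `F'' u₀ > 0`, and its second derivative there is `(F'' u₀)⁻¹`. -/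
theorem legendre_second_deriv {F G H : ℝ → ℝ} {u₀ : ℝ} (hF : ∀ u, HasDerivAt F (G u) u)
    (hG : ∀ u, HasDerivAt G (H u) u) (hH : ∀ u, 0 ≤ H u) (hHc : Continuous H)
    (h0 : 0 < H u₀) :
    ∃ g : ℝ → ℝ,
      (∀ᶠ y in nhds (G u₀), HasDerivAt (fun y => ⨆ u : ℝ, (y * u - F u)) (g y) y) ∧
      HasDerivAt g (H u₀)⁻¹ (G u₀) := by
  have hGmono : Monotone G := monotone_of_hasDerivAt_nonneg hG hH
  have htangent : ∀ u v, G u * v - F v ≤ G u * u - F u := by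
    intro u v
    have hd : ∀ v, HasDerivAt (fun v => F v - G u * v) (G v - G u) v := fun v =>
      ((hF v).fun_sub ((hasDerivAt_id v).const_mul (G u))).congr_deriv (by ring)
    suffices h : F u - G u * u ≤ F v - G u * v by linarith
    rcases le_total u v with huv | hvu
    · refine monotoneOn_of_deriv_nonneg (convex_Ici u)
        (fun x _ => (hd x).continuousAt.continuousWithinAt)
        (fun x _ => (hd x).differentiableAt.differentiableWithinAt) ?_
        (mem_Ici.2 le_rfl) (mem_Ici.2 huv) huv
      intro x hx
      rw [interior_Ici] at hx
      rw [(hd x).deriv]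
      exact sub_nonneg.2 (hGmono (le_of_lt hx))
    · refine antitoneOn_of_deriv_nonpos (convex_Iic u)
        (fun x _ => (hd x).continuousAt.continuousWithinAt)
        (fun x _ => (hd x).differentiableAt.differentiableWithinAt) ?_
        (mem_Iic.2 hvu) (mem_Iic.2 le_rfl) hvu
      intro x hx
      rw [interior_Iic] at hx
      rw [(hd x).deriv]
      exact sub_nonpos.2 (hGmono (le_of_lt hx))
  have hsup : ∀ u, (⨆ v : ℝ, (G u * v - F v)) = G u * u - F u := fun u =>
    le_antisymm (ciSup_le (htangent u))
      (le_ciSup (f := fun v => G u * v - F v)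
        ⟨_, forall_mem_range.2 (htangent u)⟩ u)
  have hstrict : HasStrictDerivAt G (H u₀) u₀ :=
    hasStrictDerivAt_of_hasDerivAt_of_continuousAt (Eventually.of_forall hG) hHc.continuousAt
  let P := (hstrict.hasStrictFDerivAt_equiv h0.ne').toOpenPartialHomeomorph G
  have hsrc : u₀ ∈ P.source :=
    (hstrict.hasStrictFDerivAt_equiv h0.ne').mem_toOpenPartialHomeomorph_source
  have htgt : G u₀ ∈ P.target := P.map_source hsrc
  have hinv : ∀ y ∈ P.target, G (P.symm y) = y := fun y hy => P.right_inv hy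
  have hcont : ∀ y ∈ P.target, ContinuousAt P.symm y := fun y hy => P.continuousAt_symm hy
  have hsymm0 : P.symm (G u₀) = u₀ := P.left_inv hsrc
  have hevt : ∀ y ∈ P.target, ∀ᶠ z in nhds y, z ∈ P.target := fun y hy =>
    P.open_target.mem_nhds hy
  have hderiv : ∀ y ∈ P.target, H (P.symm y) ≠ 0 →
      HasDerivAt P.symm (H (P.symm y))⁻¹ y := fun y hy hne =>
    HasDerivAt.of_local_left_inverse (hcont y hy) (hG _) hne ((hevt y hy).mono hinv)
  have hne : ∀ᶠ y in nhds (G u₀), H (P.symm y) ≠ 0 := by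
    have hc : ContinuousAt (fun y => H (P.symm y)) (G u₀) :=
      hHc.continuousAt.comp (hcont _ htgt)
    exact hc.eventually_ne (by rw [hsymm0]; exact h0.ne')
  refine ⟨P.symm, ?_, ?_⟩
  · filter_upwards [hne, hevt _ htgt] with y hy hyt
    have hd : HasDerivAt (fun y => y * P.symm y - F (P.symm y)) (P.symm y) y := by
      have h1 := hderiv y hyt hy
      have h2 := ((hasDerivAt_id y).mul h1).sub ((hF (P.symm y)).comp y h1)
      refine h2.congr_deriv ?_
      rw [hinv y hyt]
      simp
    refine hd.congr_of_eventuallyEq ?_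
    filter_upwards [hevt y hyt] with z hz
    have := hsup (P.symm z)
    rwa [hinv z hz] at this
  · have := hderiv _ htgt hne.self_of_nhds
    rwa [hsymm0] at this

section Integrand

variable {b : ℝ}

theorem exp_neg_abs_le_mix (hb0 : 0 ≤ b) (hb1 : b ≤ 1) (u : ℝ) :
    exp (-|u|) ≤ 1 - (1 - exp u) * b := by
  have h1 : exp (-|u|) ≤ 1 := exp_le_one_iff.2 (by simp)
  have h2 : exp (-|u|) ≤ exp u := exp_le_exp.2 (neg_abs_le u)
  nlinarith [mul_nonneg hb0 (sub_nonneg.2 h2), mul_nonneg (sub_nonneg.2 hb1) (sub_nonneg.2 h1)]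

theorem mix_pos (hb0 : 0 ≤ b) (hb1 : b ≤ 1) (u : ℝ) : 0 < 1 - (1 - exp u) * b :=
  (exp_pos _).trans_le (exp_neg_abs_le_mix hb0 hb1 u)

theorem inv_mix_le (hb0 : 0 ≤ b) (hb1 : b ≤ 1) (u : ℝ) :
    (1 - (1 - exp u) * b)⁻¹ ≤ exp |u| := by
  rw [← inv_inv (exp |u|), ← Real.exp_neg]
  exact inv_anti₀ (exp_pos _) (exp_neg_abs_le_mix hb0 hb1 u)

theorem abs_log_mix_le (hb0 : 0 ≤ b) (hb1 : b ≤ 1) (u : ℝ) :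
    |log (1 - (1 - exp u) * b)| ≤ exp |u| * b := by
  have hD := mix_pos hb0 hb1 u
  have hM := inv_mix_le hb0 hb1 u
  have hE : exp u ≤ exp |u| := exp_le_exp.2 (le_abs_self u)
  rw [abs_le]
  constructor
  · have h1 := Real.log_le_sub_one_of_pos (inv_pos.2 hD)
    rw [Real.log_inv] at h1
    have h2 : (1 - (1 - exp u) * b)⁻¹ - 1 = (1 - exp u) * b * (1 - (1 - exp u) * b)⁻¹ := by
      field_simp
      ring
    have h3 : (1 - exp u) * b * (1 - (1 - exp u) * b)⁻¹ ≤ b * (1 - (1 - exp u) * b)⁻¹ := by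
      refine mul_le_mul_of_nonneg_right ?_ (inv_pos.2 hD).le
      nlinarith [exp_pos u]
    have h4 := mul_le_mul_of_nonneg_left hM hb0
    linarith
  · have h1 := Real.log_le_sub_one_of_pos hD
    nlinarith [mul_le_mul_of_nonneg_right hE hb0]

theorem hasDerivAt_log_mix (hb0 : 0 ≤ b) (hb1 : b ≤ 1) (u : ℝ) :
    HasDerivAt (fun u => log (1 - (1 - exp u) * b))
      (exp u * b / (1 - (1 - exp u) * b)) u := by
  have h := ((((Real.hasDerivAt_exp u).const_sub 1).mul_const b).const_sub 1).log
    (mix_pos hb0 hb1 u).ne'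
  refine h.congr_deriv ?_
  ring

theorem hasDerivAt_logistic_mix (hb0 : 0 ≤ b) (hb1 : b ≤ 1) (u : ℝ) :
    HasDerivAt (fun u => exp u * b / (1 - (1 - exp u) * b))
      (exp u * b * (1 - b) / (1 - (1 - exp u) * b) ^ 2) u := by
  have h := ((Real.hasDerivAt_exp u).mul_const b).div
    ((((Real.hasDerivAt_exp u).const_sub 1).mul_const b).const_sub 1) (mix_pos hb0 hb1 u).ne'
  refine h.congr_deriv ?_
  congr 1
  ring

theorem abs_logistic_mix_le (hb0 : 0 ≤ b) (hb1 : b ≤ 1) (u : ℝ) :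
    |exp u * b / (1 - (1 - exp u) * b)| ≤ exp |u| ^ 2 * b := by
  have hD := mix_pos hb0 hb1 u
  have hE : exp u ≤ exp |u| := exp_le_exp.2 (le_abs_self u)
  rw [abs_of_nonneg (by positivity), div_eq_mul_inv]
  calc exp u * b * (1 - (1 - exp u) * b)⁻¹ ≤ exp |u| * b * exp |u| := by
        gcongr
        exact inv_mix_le hb0 hb1 u
    _ = exp |u| ^ 2 * b := by ring

theorem abs_logistic_deriv_mix_le (hb0 : 0 ≤ b) (hb1 : b ≤ 1) (u : ℝ) :
    |exp u * b * (1 - b) / (1 - (1 - exp u) * b) ^ 2| ≤ exp |u| ^ 3 * b := by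
  have hD := mix_pos hb0 hb1 u
  have hE : exp u ≤ exp |u| := exp_le_exp.2 (le_abs_self u)
  have hb2 : 0 ≤ 1 - b := sub_nonneg.2 hb1
  rw [abs_of_nonneg (by positivity), div_eq_mul_inv, ← inv_pow]
  calc exp u * b * (1 - b) * (1 - (1 - exp u) * b)⁻¹ ^ 2
      ≤ exp |u| * b * 1 * exp |u| ^ 2 := by
        gcongr
        · linarith
        · exact inv_mix_le hb0 hb1 u
    _ = exp |u| ^ 3 * b := by ring

end Integrand

theorem exp_neg_sq_le_one (t : ℝ) : exp (-t ^ 2) ≤ 1 :=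
  exp_le_one_iff.2 (neg_nonpos.2 (sq_nonneg t))

theorem integrable_exp_neg_sq : Integrable fun t : ℝ => exp (-t ^ 2) := by
  simpa using integrable_exp_neg_mul_sq one_pos

theorem exp_abs_le_of_mem_ball {u v : ℝ} (h : v ∈ Metric.ball u 1) :
    exp |v| ≤ exp (|u| + 1) := by
  rw [Metric.mem_ball, Real.dist_eq] at h
  exact exp_le_exp.2 (by linarith [abs_sub_abs_le_abs_sub v u])

theorem hasDerivAt_integral_log_mix (u : ℝ) :
    HasDerivAt (fun u => ∫ t in Ioi (0 : ℝ), log (1 - (1 - exp u) * exp (-t ^ 2)))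
      (∫ t in Ioi (0 : ℝ), exp u * exp (-t ^ 2) / (1 - (1 - exp u) * exp (-t ^ 2))) u := by
  refine (hasDerivAt_integral_of_dominated_loc_of_deriv_le
    (F := fun u t => log (1 - (1 - exp u) * exp (-t ^ 2)))
    (F' := fun u t => exp u * exp (-t ^ 2) / (1 - (1 - exp u) * exp (-t ^ 2)))
    (bound := fun t => exp (|u| + 1) ^ 2 * exp (-t ^ 2))
    (Metric.ball_mem_nhds u one_pos) (Eventually.of_forall fun v => ?_) ?_ ?_
    (Eventually.of_forall fun t v hv => ?_) ?_ (Eventually.of_forall fun t v _ => ?_)).2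
  · exact Measurable.aestronglyMeasurable (by fun_prop)
  · refine (integrable_exp_neg_sq.integrableOn.const_mul (exp |u|)).mono'
      (Measurable.aestronglyMeasurable (by fun_prop)) (Eventually.of_forall fun t => ?_)
    exact abs_log_mix_le (exp_pos _).le (exp_neg_sq_le_one t) u
  · exact Measurable.aestronglyMeasurable (by fun_prop)
  · refine (abs_logistic_mix_le (exp_pos _).le (exp_neg_sq_le_one t) v).trans ?_
    gcongr ?_ ^ 2 * _
    exact exp_abs_le_of_mem_ball hv
  · exact integrable_exp_neg_sq.integrableOn.const_mul _
  · exact hasDerivAt_log_mix (exp_pos _).le (exp_neg_sq_le_one t) v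

theorem hasDerivAt_integral_logistic_mix (u : ℝ) :
    HasDerivAt
      (fun u => ∫ t in Ioi (0 : ℝ), exp u * exp (-t ^ 2) / (1 - (1 - exp u) * exp (-t ^ 2)))
      (∫ t in Ioi (0 : ℝ), exp u * exp (-t ^ 2) * (1 - exp (-t ^ 2)) /
        (1 - (1 - exp u) * exp (-t ^ 2)) ^ 2) u := by
  refine (hasDerivAt_integral_of_dominated_loc_of_deriv_le
    (F := fun u t => exp u * exp (-t ^ 2) / (1 - (1 - exp u) * exp (-t ^ 2)))
    (F' := fun u t => exp u * exp (-t ^ 2) * (1 - exp (-t ^ 2)) /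
      (1 - (1 - exp u) * exp (-t ^ 2)) ^ 2)
    (bound := fun t => exp (|u| + 1) ^ 3 * exp (-t ^ 2))
    (Metric.ball_mem_nhds u one_pos) (Eventually.of_forall fun v => ?_) ?_ ?_
    (Eventually.of_forall fun t v hv => ?_) ?_ (Eventually.of_forall fun t v _ => ?_)).2
  · exact Measurable.aestronglyMeasurable (by fun_prop)
  · refine (integrable_exp_neg_sq.integrableOn.const_mul (exp |u| ^ 2)).mono'
      (Measurable.aestronglyMeasurable (by fun_prop)) (Eventually.of_forall fun t => ?_)
    exact abs_logistic_mix_le (exp_pos _).le (exp_neg_sq_le_one t) u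
  · exact Measurable.aestronglyMeasurable (by fun_prop)
  · refine (abs_logistic_deriv_mix_le (exp_pos _).le (exp_neg_sq_le_one t) v).trans ?_
    gcongr ?_ ^ 3 * _
    exact exp_abs_le_of_mem_ball hv
  · exact integrable_exp_neg_sq.integrableOn.const_mul _
  · exact hasDerivAt_logistic_mix (exp_pos _).le (exp_neg_sq_le_one t) v

theorem continuous_integral_logistic_deriv_mix :
    Continuous fun u => ∫ t in Ioi (0 : ℝ), exp u * exp (-t ^ 2) * (1 - exp (-t ^ 2)) /
      (1 - (1 - exp u) * exp (-t ^ 2)) ^ 2 := by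
  refine continuous_iff_continuousAt.2 fun u => ?_
  refine continuousAt_of_dominated (bound := fun t => exp (|u| + 1) ^ 3 * exp (-t ^ 2))
    (Eventually.of_forall fun v => ?_) ?_ ?_ (Eventually.of_forall fun t => ?_)
  · exact Measurable.aestronglyMeasurable (by fun_prop)
  · filter_upwards [Metric.ball_mem_nhds u one_pos] with v hv
    refine Eventually.of_forall fun t => ?_
    refine (abs_logistic_deriv_mix_le (exp_pos _).le (exp_neg_sq_le_one t) v).trans ?_
    gcongr ?_ ^ 3 * _
    exact exp_abs_le_of_mem_ball hv
  · exact integrable_exp_neg_sq.integrableOn.const_mul _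
  · refine ContinuousAt.div (by fun_prop) (by fun_prop) ?_
    exact pow_ne_zero 2 (mix_pos (exp_pos _).le (exp_neg_sq_le_one t) u).ne'

theorem integral_Ioi_exp_neg_sq : ∫ t in Ioi (0 : ℝ), exp (-t ^ 2) = √π / 2 := by
  simpa using integral_gaussian_Ioi 1

theorem integral_Ioi_exp_neg_sq_mul_one_sub :
    ∫ t in Ioi (0 : ℝ), exp (-t ^ 2) * (1 - exp (-t ^ 2)) = √π / 2 * (1 - √2 / 2) := by
  have h : ∀ t : ℝ, exp (-t ^ 2) * (1 - exp (-t ^ 2)) = exp (-t ^ 2) - exp (-2 * t ^ 2) := by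
    intro t
    rw [mul_sub, mul_one, ← Real.exp_add]
    ring_nf
  simp_rw [h]
  rw [integral_sub integrable_exp_neg_sq.integrableOn
    (integrable_exp_neg_mul_sq two_pos).integrableOn, integral_Ioi_exp_neg_sq,
    integral_gaussian_Ioi, Real.sqrt_div pi_pos.le]
  have h2 : √2 * √2 = 2 := Real.mul_self_sqrt zero_le_two
  field_simp
  linear_combination h2

/-- **Curvature of the strong-asymmetry rate function at its minimiser.** For
`τ ∈ [0,1)`, the function `φ_s(·;τ)` is twice differentiable at its minimiser
`x_s = √((2/π)·(1+τ)/(1-τ))`, with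
`φ_s''(x_s;τ) = 1 / ((2-√2) √((2/π)·(1+τ)/(1-τ)))`. -/
theorem phiS_second_deriv_at_min (τ : ℝ) (hτ0 : 0 ≤ τ) (hτ1 : τ < 1) :
    ∃ φ' : ℝ → ℝ,
      (∀ᶠ x in nhds (Real.sqrt ((2 / π) * ((1 + τ) / (1 - τ)))),
        HasDerivAt (phiS τ) (φ' x) x) ∧
      HasDerivAt φ'
        (1 / ((2 - Real.sqrt 2) * Real.sqrt ((2 / π) * ((1 + τ) / (1 - τ)))))
        (Real.sqrt ((2 / π) * ((1 + τ) / (1 - τ)))) := by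
  have hτ : 0 < 1 - τ := sub_pos.2 hτ1
  set A := √((1 + τ) / ((1 - τ) * (2 * π)))
  have hApos : 0 < A := Real.sqrt_pos.2 (by positivity)
  have hxs : √((2 / π) * ((1 + τ) / (1 - τ))) = 2 * A := by
    rw [Real.sqrt_eq_iff_mul_self_eq (by positivity) (by positivity)]
    have h : A * A = (1 + τ) / ((1 - τ) * (2 * π)) := Real.mul_self_sqrt (by positivity)
    rw [show 2 * A * (2 * A) = 4 * (A * A) by ring, h]
    field_simp
    norm_num
  have hπ : 0 < √π := Real.sqrt_pos.2 pi_pos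
  have h2 : √2 < 2 := by
    rw [Real.sqrt_lt' two_pos]
    norm_num
  have hF := fun u => ((hasDerivAt_integral_log_mix u).const_mul (2 / √π)).const_mul A
  have hG := fun u => ((hasDerivAt_integral_logistic_mix u).const_mul (2 / √π)).const_mul A
  have hHc := (continuous_integral_logistic_deriv_mix.const_mul (2 / √π)).const_mul A
  have hG0 : A * (2 / √π * ∫ t in Ioi (0 : ℝ), exp 0 * exp (-t ^ 2) /
      (1 - (1 - exp 0) * exp (-t ^ 2))) = A := by
    simp only [Real.exp_zero, sub_self, zero_mul, sub_zero, one_mul, div_one,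
      integral_Ioi_exp_neg_sq]
    field_simp
  have hH0 : A * (2 / √π * ∫ t in Ioi (0 : ℝ), exp 0 * exp (-t ^ 2) * (1 - exp (-t ^ 2)) /
      (1 - (1 - exp 0) * exp (-t ^ 2)) ^ 2) = A * (1 - √2 / 2) := by
    simp only [Real.exp_zero, sub_self, zero_mul, sub_zero, one_mul, one_pow, div_one,
      integral_Ioi_exp_neg_sq_mul_one_sub]
    field_simp
  have hH : ∀ u, 0 ≤ A * (2 / √π * ∫ t in Ioi (0 : ℝ),
      exp u * exp (-t ^ 2) * (1 - exp (-t ^ 2)) / (1 - (1 - exp u) * exp (-t ^ 2)) ^ 2) := by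
    intro u
    have : 0 ≤ ∫ t in Ioi (0 : ℝ),
        exp u * exp (-t ^ 2) * (1 - exp (-t ^ 2)) / (1 - (1 - exp u) * exp (-t ^ 2)) ^ 2 :=
      integral_nonneg fun t => by
        have := sub_nonneg.2 (exp_neg_sq_le_one t)
        positivity
    positivity
  obtain ⟨g, hg1, hg2⟩ := legendre_second_deriv (u₀ := 0) hF hG hH hHc
    (by rw [hH0]; exact mul_pos hApos (by linarith))
  rw [hG0] at hg1 hg2
  rw [hH0] at hg2
  rw [hxs]
  have hhalf : ∀ x : ℝ, HasDerivAt (fun x : ℝ => x / 2) (1 / 2) x := fun x =>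
    (hasDerivAt_id x).div_const 2
  have hmid : 2 * A / 2 = A := by ring
  refine ⟨fun x => g (x / 2) * (1 / 2), ?_, ?_⟩
  · have htend : Tendsto (fun x : ℝ => x / 2) (nhds (2 * A)) (nhds A) := by
      have := (hhalf (2 * A)).continuousAt.tendsto
      rwa [hmid] at this
    filter_upwards [htend.eventually hg1] with x hx
    exact hx.comp x (hhalf x)
  · rw [← hmid] at hg2
    refine ((hg2.comp (2 * A) (hhalf _)).mul_const (1 / 2)).congr_deriv ?_
    rw [hmid]
    have h3 : 2 - √2 ≠ 0 := by linarith
    have h4 : 1 - √2 / 2 = (2 - √2) / 2 := by ring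
    rw [h4]
    field_simp
end

section
/- Fix \alpha > 0. Then \sup_{u \in \mathbb{R}} \{ u/2 - \Psi_w(e^u;\alpha) \} = \alpha^2 / 8, the supremum is not attained, and it equals \lim_{u\to\infty} ( u/2 - \Psi_w(e^u;\alpha) ). Equivalently, \lim_{x \to 1^-} \phi_w(x;\alpha) = \alpha^2/8. -/
open Real Set MeasureTheory Filter

/-- `Ψ_w(z;α) = (2/π) ∫_0^1 log(1 - (1-z) e^{-α²s²}) √(1-s²) ds`. -/
noncomputable def PsiW (α z : ℝ) : ℝ :=
  (2 / Real.pi) *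
    ∫ s in (0:ℝ)..1, Real.log (1 - (1 - z) * Real.exp (-α ^ 2 * s ^ 2)) * Real.sqrt (1 - s ^ 2)

/-- `φ_w(x;α) = sup_{u ∈ ℝ} { (x/2) u - Ψ_w(e^u;α) }`. -/
noncomputable def phiW (α x : ℝ) : ℝ :=
  ⨆ u : ℝ, ((x / 2) * u - PsiW α (Real.exp u))

/-- `c(α) = (4/π) ∫_0^1 e^{-α²s²} √(1-s²) ds`. -/
noncomputable def cFun (α : ℝ) : ℝ :=
  (4 / Real.pi) * ∫ s in (0:ℝ)..1, Real.exp (-α ^ 2 * s ^ 2) * Real.sqrt (1 - s ^ 2)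

theorem integral_sqrt_one_sub_sq_zero_one :
    ∫ s in (0:ℝ)..1, Real.sqrt (1 - s ^ 2) = Real.pi / 4 := by
  have h := intervalIntegral.integral_eq_sub_of_hasDerivAt_of_le (a := 0) (b := 1)
    (f := fun s : ℝ => (Real.arcsin s + s * Real.sqrt (1 - s ^ 2)) / 2)
    (f' := fun s : ℝ => Real.sqrt (1 - s ^ 2)) zero_le_one
    (by have := Real.continuous_arcsin; fun_prop) ?_
    ((by fun_prop : Continuous fun s : ℝ => Real.sqrt (1 - s ^ 2)).intervalIntegrable _ _)
  · rw [h]; simp; ring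
  · rintro s ⟨h0, h1⟩
    have hp : 0 < 1 - s ^ 2 := by nlinarith
    have hq := Real.sqrt_pos.2 hp
    have hsq := Real.sq_sqrt hp.le
    have hd : HasDerivAt (fun s : ℝ => 1 - s ^ 2) (-(2 * s)) s := by
      simpa using (hasDerivAt_pow 2 s).const_sub 1
    refine HasDerivAt.congr_deriv (((Real.hasDerivAt_arcsin (by linarith : s ≠ -1) h1.ne).add
      ((hasDerivAt_id s).mul (hd.sqrt hp.ne'))).div_const 2) ?_
    simp only [id]
    field_simp
    rw [hsq]; ring

theorem integral_sq_mul_sqrt_one_sub_sq_zero_one :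
    ∫ s in (0:ℝ)..1, s ^ 2 * Real.sqrt (1 - s ^ 2) = Real.pi / 16 := by
  have h := intervalIntegral.integral_eq_sub_of_hasDerivAt_of_le (a := 0) (b := 1)
    (f := fun s : ℝ => (Real.arcsin s + (2 * s ^ 3 - s) * Real.sqrt (1 - s ^ 2)) / 8)
    (f' := fun s : ℝ => s ^ 2 * Real.sqrt (1 - s ^ 2)) zero_le_one
    (by have := Real.continuous_arcsin; fun_prop) ?_
    ((by fun_prop : Continuous fun s : ℝ => s ^ 2 * Real.sqrt (1 - s ^ 2)).intervalIntegrable _ _)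
  · rw [h]; simp; ring
  · rintro s ⟨h0, h1⟩
    have hp : 0 < 1 - s ^ 2 := by nlinarith
    have hq := Real.sqrt_pos.2 hp
    have hsq := Real.sq_sqrt hp.le
    have hd : HasDerivAt (fun s : ℝ => 1 - s ^ 2) (-(2 * s)) s := by
      simpa using (hasDerivAt_pow 2 s).const_sub 1
    have hc : HasDerivAt (fun s : ℝ => 2 * s ^ 3 - s) (6 * s ^ 2 - 1) s := by
      refine (((hasDerivAt_pow 3 s).const_mul 2).sub (hasDerivAt_id s)).congr_deriv ?_
      norm_num
      ring
    refine HasDerivAt.congr_deriv (((Real.hasDerivAt_arcsin (by linarith : s ≠ -1) h1.ne).add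
      (hc.mul (hd.sqrt hp.ne'))).div_const 8) ?_
    field_simp
    rw [hsq]; ring

theorem integral_affine_sq_mul_sqrt (a b : ℝ) :
    ∫ s in (0:ℝ)..1, (a + b * s ^ 2) * Real.sqrt (1 - s ^ 2)
      = a * (Real.pi / 4) + b * (Real.pi / 16) := by
  rw [← integral_sqrt_one_sub_sq_zero_one, ← integral_sq_mul_sqrt_one_sub_sq_zero_one,
    ← intervalIntegral.integral_const_mul, ← intervalIntegral.integral_const_mul,
    ← intervalIntegral.integral_add]
  · congr 1; ext s; ring
  all_goals exact Continuous.intervalIntegrable (by fun_prop) _ _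

theorem one_add_exp_neg_mul_pos {a : ℝ} (ha : 0 ≤ a) (u : ℝ) :
    0 < 1 + Real.exp (-u) * (Real.exp a - 1) := by
  have := mul_nonneg (Real.exp_pos (-u)).le (sub_nonneg.2 (Real.one_le_exp ha))
  linarith

theorem one_sub_one_sub_exp_mul_exp_neg (u a : ℝ) :
    1 - (1 - Real.exp u) * Real.exp (-a)
      = Real.exp (u - a) * (1 + Real.exp (-u) * (Real.exp a - 1)) := by
  have h1 : Real.exp (u - a) * Real.exp (-u) * Real.exp a = 1 := by
    rw [← Real.exp_add, ← Real.exp_add, Real.exp_eq_one_iff]; ring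
  have h2 : Real.exp (u - a) * Real.exp (-u) = Real.exp (-a) := by
    rw [← Real.exp_add]; congr 1; ring
  have h3 : Real.exp (u - a) = Real.exp u * Real.exp (-a) := by
    rw [← Real.exp_add]; congr 1
  linear_combination (-1 : ℝ) * h1 + h2 - h3

theorem log_one_sub_one_sub_exp_mul_exp_neg {a : ℝ} (ha : 0 ≤ a) (u : ℝ) :
    Real.log (1 - (1 - Real.exp u) * Real.exp (-a))
      = u - a + Real.log (1 + Real.exp (-u) * (Real.exp a - 1)) := by
  rw [one_sub_one_sub_exp_mul_exp_neg, Real.log_mul (Real.exp_pos _).ne'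
    (one_add_exp_neg_mul_pos ha u).ne', Real.log_exp]

theorem mul_log_one_add_le {θ b y : ℝ} (h0 : 0 ≤ θ) (h1 : θ ≤ 1) (hb : θ ≤ b) (hy : 0 ≤ y) :
    θ * Real.log (1 + y) ≤ Real.log (1 + y * b) := by
  rw [← Real.log_rpow (by linarith)]
  refine Real.log_le_log (Real.rpow_pos_of_pos (by linarith) _) ?_
  have := rpow_one_add_le_one_add_mul_self (by linarith : -1 ≤ y) h0 h1
  nlinarith

theorem intervalIntegrable_PsiW (α u : ℝ) :
    IntervalIntegrable (fun s : ℝ => Real.log (1 - (1 - Real.exp u) *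
      Real.exp (-α ^ 2 * s ^ 2)) * Real.sqrt (1 - s ^ 2)) volume 0 1 := by
  refine Continuous.intervalIntegrable ?_ _ _
  refine Continuous.mul (Continuous.log (by fun_prop) fun s => ?_) (by fun_prop)
  rw [neg_mul, one_sub_one_sub_exp_mul_exp_neg]
  exact (mul_pos (Real.exp_pos _) (one_add_exp_neg_mul_pos (by positivity) u)).ne'

theorem le_PsiW_exp (α u : ℝ) :
    u / 2 - α ^ 2 / 8 + min 1 (α ^ 2) / 8 * Real.log (1 + Real.exp (-u))
      ≤ PsiW α (Real.exp u) := by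
  set L := Real.log (1 + Real.exp (-u))
  have h : ∫ s in (0:ℝ)..1, (u + (min 1 (α ^ 2) * L - α ^ 2) * s ^ 2) * Real.sqrt (1 - s ^ 2)
      ≤ ∫ s in (0:ℝ)..1, Real.log (1 - (1 - Real.exp u) * Real.exp (-α ^ 2 * s ^ 2)) *
        Real.sqrt (1 - s ^ 2) := by
    refine intervalIntegral.integral_mono_on zero_le_one
      (Continuous.intervalIntegrable (by fun_prop) _ _) (intervalIntegrable_PsiW α u) ?_
    rintro s ⟨h0, h1⟩
    refine mul_le_mul_of_nonneg_right ?_ (Real.sqrt_nonneg _)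
    rw [neg_mul, log_one_sub_one_sub_exp_mul_exp_neg (by positivity)]
    have hs : s ^ 2 ≤ 1 := by nlinarith
    have hm : 0 ≤ min 1 (α ^ 2) := le_min zero_le_one (sq_nonneg α)
    have hk := mul_log_one_add_le (θ := min 1 (α ^ 2) * s ^ 2) (b := Real.exp (α ^ 2 * s ^ 2) - 1)
      (by positivity) (mul_le_one₀ (min_le_left _ _) (sq_nonneg s) hs)
      (by
        have := mul_le_mul_of_nonneg_right (min_le_right 1 (α ^ 2)) (sq_nonneg s)
        have := Real.add_one_le_exp (α ^ 2 * s ^ 2)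
        linarith) (Real.exp_pos (-u)).le
    linarith
  rw [integral_affine_sq_mul_sqrt] at h
  have := mul_le_mul_of_nonneg_left h (by positivity : 0 ≤ 2 / Real.pi)
  refine le_of_eq_of_le ?_ this
  field_simp
  ring

theorem PsiW_exp_le (α u : ℝ) :
    PsiW α (Real.exp u)
      ≤ u / 2 - α ^ 2 / 8 + Real.exp (-u) * (Real.exp (α ^ 2) - 1) / 2 := by
  have h : ∫ s in (0:ℝ)..1, Real.log (1 - (1 - Real.exp u) * Real.exp (-α ^ 2 * s ^ 2)) *
        Real.sqrt (1 - s ^ 2)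
      ≤ ∫ s in (0:ℝ)..1, (u + Real.exp (-u) * (Real.exp (α ^ 2) - 1) + -α ^ 2 * s ^ 2) *
        Real.sqrt (1 - s ^ 2) := by
    refine intervalIntegral.integral_mono_on zero_le_one (intervalIntegrable_PsiW α u)
      (Continuous.intervalIntegrable (by fun_prop) _ _) ?_
    rintro s ⟨h0, h1⟩
    refine mul_le_mul_of_nonneg_right ?_ (Real.sqrt_nonneg _)
    rw [neg_mul, log_one_sub_one_sub_exp_mul_exp_neg (by positivity)]
    have hs : s ^ 2 ≤ 1 := by nlinarith
    have hl := Real.log_le_sub_one_of_pos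
      (one_add_exp_neg_mul_pos (a := α ^ 2 * s ^ 2) (by positivity) u)
    have he : Real.exp (α ^ 2 * s ^ 2) ≤ Real.exp (α ^ 2) :=
      Real.exp_le_exp.2 (mul_le_of_le_one_right (sq_nonneg α) hs)
    have := mul_le_mul_of_nonneg_left (sub_le_sub_right he 1) (Real.exp_pos (-u)).le
    linarith
  rw [integral_affine_sq_mul_sqrt] at h
  have := mul_le_mul_of_nonneg_left h (by positivity : 0 ≤ 2 / Real.pi)
  refine le_of_le_of_eq this ?_
  field_simp
  ring

theorem half_sub_PsiW_exp_lt {α : ℝ} (hα : 0 < α) (u : ℝ) :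
    u / 2 - PsiW α (Real.exp u) < α ^ 2 / 8 := by
  have h := le_PsiW_exp α u
  have hm : 0 < min 1 (α ^ 2) := lt_min one_pos (by positivity)
  have hl : 0 < Real.log (1 + Real.exp (-u)) :=
    Real.log_pos (by linarith [Real.exp_pos (-u)])
  have := mul_pos (div_pos hm (by norm_num : (0:ℝ) < 8)) hl
  linarith

theorem tendsto_half_sub_PsiW_exp {α : ℝ} (hα : 0 < α) :
    Tendsto (fun u : ℝ => u / 2 - PsiW α (Real.exp u)) atTop (nhds (α ^ 2 / 8)) := by
  have hlow : Tendsto (fun u : ℝ => α ^ 2 / 8 - Real.exp (-u) * (Real.exp (α ^ 2) - 1) / 2)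
      atTop (nhds (α ^ 2 / 8)) := by
    simpa using ((Real.tendsto_exp_neg_atTop_nhds_zero.mul_const
      (Real.exp (α ^ 2) - 1)).div_const 2).const_sub (α ^ 2 / 8)
  refine tendsto_of_tendsto_of_tendsto_of_le_of_le hlow tendsto_const_nhds
    (fun u => ?_) fun u => (half_sub_PsiW_exp_lt hα u).le
  have := PsiW_exp_le α u
  dsimp only
  linarith

/-- Close to `x = 1` the tilted functional is still bounded by `α ^ 2 / 8`. -/
theorem half_mul_sub_PsiW_exp_le {α x : ℝ} (hx : x ≤ 1) (hx' : 1 - min 1 (α ^ 2) / 4 ≤ x)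
    (u : ℝ) : x / 2 * u - PsiW α (Real.exp u) ≤ α ^ 2 / 8 := by
  have h := le_PsiW_exp α u
  have hm : 0 ≤ min 1 (α ^ 2) := le_min zero_le_one (sq_nonneg α)
  have hpos := Real.exp_pos (-u)
  rcases le_total 0 u with hu | hu
  · have hl : 0 ≤ Real.log (1 + Real.exp (-u)) := Real.log_nonneg (by linarith)
    have := mul_nonneg (div_nonneg hm (by norm_num : (0:ℝ) ≤ 8)) hl
    nlinarith
  · have hl : -u ≤ Real.log (1 + Real.exp (-u)) := by
      rw [Real.le_log_iff_exp_le (by linarith)]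
      linarith
    have := mul_le_mul_of_nonneg_left hl (div_nonneg hm (by norm_num : (0:ℝ) ≤ 8))
    nlinarith

theorem tendsto_phiW {α : ℝ} (hα : 0 < α) :
    Tendsto (fun x : ℝ => phiW α x) (nhdsWithin 1 (Set.Iio 1)) (nhds (α ^ 2 / 8)) := by
  have hm : 0 < min 1 (α ^ 2) := lt_min one_pos (by positivity)
  have hmem : ∀ᶠ x : ℝ in nhdsWithin 1 (Set.Iio 1), ∀ u : ℝ,
      x / 2 * u - PsiW α (Real.exp u) ≤ α ^ 2 / 8 := by
    filter_upwards [Ioo_mem_nhdsLT (by linarith : 1 - min 1 (α ^ 2) / 4 < 1)] with x hx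
    exact half_mul_sub_PsiW_exp_le hx.2.le hx.1.le
  refine tendsto_order.2 ⟨fun c hc => ?_, fun c hc => ?_⟩
  · obtain ⟨u, hu⟩ := ((tendsto_half_sub_PsiW_exp hα).eventually_const_lt hc).exists
    have hcont : Tendsto (fun x : ℝ => x / 2 * u - PsiW α (Real.exp u)) (nhdsWithin 1 (Set.Iio 1))
        (nhds (1 / 2 * u - PsiW α (Real.exp u))) :=
      (Continuous.tendsto (by fun_prop) 1).mono_left nhdsWithin_le_nhds
    filter_upwards [hmem, hcont.eventually_const_lt (by linarith : c < _)] with x hx hxu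
    exact hxu.trans_le (le_ciSup (f := fun u : ℝ => x / 2 * u - PsiW α (Real.exp u))
      ⟨α ^ 2 / 8, Set.forall_mem_range.2 hx⟩ u)
  · filter_upwards [hmem] with x hx
    exact (ciSup_le hx).trans_lt hc

/-- **Right-tail limit of the weak-asymmetry rate function.** For `α > 0`,
`sup_u { u/2 - Ψ_w(e^u;α) } = α²/8`; the supremum is not attained and equals the limit
as `u → ∞`. Equivalently, `φ_w(x;α) → α²/8` as `x → 1⁻`. -/
theorem phiW_right_tail_limit (α : ℝ) (hα : 0 < α) :
    IsLUB (Set.range fun u : ℝ => u / 2 - PsiW α (Real.exp u)) (α ^ 2 / 8) ∧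
    (∀ u : ℝ, u / 2 - PsiW α (Real.exp u) < α ^ 2 / 8) ∧
    Tendsto (fun u : ℝ => u / 2 - PsiW α (Real.exp u)) atTop (nhds (α ^ 2 / 8)) ∧
    Tendsto (fun x : ℝ => phiW α x) (nhdsWithin 1 (Set.Iio 1)) (nhds (α ^ 2 / 8)) := by
  refine ⟨⟨?_, fun b hb => ?_⟩, half_sub_PsiW_exp_lt hα, tendsto_half_sub_PsiW_exp hα,
    tendsto_phiW hα⟩
  · rintro _ ⟨u, rfl⟩
    exact (half_sub_PsiW_exp_lt hα u).le
  · exact le_of_tendsto' (tendsto_half_sub_PsiW_exp hα) fun u => hb ⟨u, rfl⟩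
end

section
/- Fix \alpha > 0. Then \lim_{x \to 0^+} \phi_w(x;\alpha) = -\Psi_w(0;\alpha) = -(2/\pi) \int_0^1 \log( 1 - e^{-\alpha^2 s^2} ) \sqrt{1-s^2} \, ds, and this quantity is finite and positive. -/
open Real Set MeasureTheory Filter

/-- The integrand of `PsiW`. -/
noncomputable def psiIntegrand (α z s : ℝ) : ℝ :=
  Real.log (1 - (1 - z) * Real.exp (-α ^ 2 * s ^ 2)) * Real.sqrt (1 - s ^ 2)

theorem PsiW_eq (α z : ℝ) : PsiW α z = (2 / π) * ∫ s in (0:ℝ)..1, psiIntegrand α z s := rfl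

theorem measurable_psiIntegrand (α z : ℝ) : Measurable (psiIntegrand α z) := by
  unfold psiIntegrand
  fun_prop

theorem exp_neg_sq_mul_sq_lt_one {α s : ℝ} (hα : 0 < α) (hs : 0 < s) :
    Real.exp (-α ^ 2 * s ^ 2) < 1 := by
  rw [Real.exp_lt_one_iff, neg_mul, neg_lt_zero]
  positivity

theorem psiIntegrand_mono {α s z w : ℝ} (hα : 0 < α) (hs : 0 < s) (hz : 0 ≤ z) (hzw : z ≤ w) :
    psiIntegrand α z s ≤ psiIntegrand α w s := by
  have hq := exp_neg_sq_mul_sq_lt_one hα hs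
  have hp := Real.exp_pos (-α ^ 2 * s ^ 2)
  unfold psiIntegrand
  refine mul_le_mul_of_nonneg_right (Real.log_le_log ?_ ?_) (Real.sqrt_nonneg _)
  · nlinarith
  · nlinarith

theorem psiIntegrand_one (α s : ℝ) : psiIntegrand α 1 s = 0 := by
  simp [psiIntegrand]

theorem log_sub_le_log_one_sub_exp_neg {y : ℝ} (hy : 0 < y) :
    Real.log y - y ≤ Real.log (1 - Real.exp (-y)) := by
  have h : y * Real.exp (-y) ≤ 1 - Real.exp (-y) := by
    have h1 := Real.add_one_le_exp y
    have h2 : Real.exp y * Real.exp (-y) = 1 := by rw [← Real.exp_add]; simp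
    nlinarith [Real.exp_pos (-y)]
  have h3 := Real.log_le_log (by positivity) h
  rwa [Real.log_mul hy.ne' (Real.exp_pos _).ne', Real.log_exp, ← sub_eq_add_neg] at h3

theorem norm_psiIntegrand_le {α s z : ℝ} (hα : 0 < α) (hs : 0 < s) (hz : 0 ≤ z) (hz1 : z ≤ 1) :
    ‖psiIntegrand α z s‖ ≤ α ^ 2 * s ^ 2 - (Real.log (α ^ 2) + 2 * Real.log s) := by
  have hy : 0 < α ^ 2 * s ^ 2 := by positivity
  have h1 := log_sub_le_log_one_sub_exp_neg hy
  rw [Real.log_mul (by positivity) (by positivity), Real.log_pow s 2, ← neg_mul] at h1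
  have h2 : psiIntegrand α z s ≤ 0 := psiIntegrand_one α s ▸ psiIntegrand_mono hα hs hz hz1
  have h3 := psiIntegrand_mono hα hs le_rfl hz
  have h4 : Real.log (1 - Real.exp (-α ^ 2 * s ^ 2)) ≤ 0 :=
    Real.log_nonpos (by linarith [exp_neg_sq_mul_sq_lt_one hα hs])
      (by linarith [Real.exp_pos (-α ^ 2 * s ^ 2)])
  have h5 : Real.sqrt (1 - s ^ 2) ≤ 1 := Real.sqrt_le_one.2 (by nlinarith)
  have h6 : Real.log (1 - Real.exp (-α ^ 2 * s ^ 2)) ≤ psiIntegrand α 0 s := by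
    simp only [psiIntegrand, sub_zero, one_mul]
    nlinarith
  rw [Real.norm_eq_abs, abs_of_nonpos h2]
  push_cast at h1
  linarith

theorem intervalIntegrable_psiIntegrand_bound (α : ℝ) :
    IntervalIntegrable (fun s : ℝ => α ^ 2 * s ^ 2 - (Real.log (α ^ 2) + 2 * Real.log s))
      volume 0 1 := by
  refine IntervalIntegrable.sub ?_ (IntervalIntegrable.add ?_ ?_)
  · exact Continuous.intervalIntegrable (by fun_prop) _ _
  · exact intervalIntegrable_const
  · exact intervalIntegral.intervalIntegrable_log'.const_mul 2

theorem intervalIntegrable_psiIntegrand {α z : ℝ} (hα : 0 < α) (hz : 0 ≤ z) (hz1 : z ≤ 1) :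
    IntervalIntegrable (psiIntegrand α z) volume 0 1 := by
  refine (intervalIntegrable_psiIntegrand_bound α).mono_fun'
    (measurable_psiIntegrand α z).aestronglyMeasurable ?_
  refine (ae_restrict_iff' measurableSet_uIoc).2 (Eventually.of_forall fun s hs => ?_)
  rw [uIoc_of_le zero_le_one] at hs
  exact norm_psiIntegrand_le hα hs.1 hz hz1

theorem intervalIntegrable_psiIntegrand_of_pos {α z : ℝ} (hz : 0 < z) :
    IntervalIntegrable (psiIntegrand α z) volume 0 1 := by
  refine Continuous.intervalIntegrable ?_ _ _
  unfold psiIntegrand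
  refine Continuous.mul (Continuous.log (by fun_prop) fun s => ?_) (by fun_prop)
  have hp := Real.exp_pos (-α ^ 2 * s ^ 2)
  have hq : Real.exp (-α ^ 2 * s ^ 2) ≤ 1 := Real.exp_le_one_iff.2 (by nlinarith [sq_nonneg (α * s)])
  have : 0 < 1 - (1 - z) * Real.exp (-α ^ 2 * s ^ 2) := by
    rcases le_total z 1 with h | h <;> nlinarith
  exact this.ne'

theorem PsiW_zero_le {α z : ℝ} (hα : 0 < α) (hz : 0 < z) : PsiW α 0 ≤ PsiW α z := by
  rw [PsiW_eq, PsiW_eq]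
  refine mul_le_mul_of_nonneg_left ?_ (by positivity)
  exact intervalIntegral.integral_mono_on_of_le_Ioo zero_le_one
    (intervalIntegrable_psiIntegrand hα le_rfl zero_le_one)
    (intervalIntegrable_psiIntegrand_of_pos hz)
    fun s hs => psiIntegrand_mono hα hs.1 le_rfl hz.le

theorem PsiW_zero_neg {α : ℝ} (hα : 0 < α) : PsiW α 0 < 0 := by
  have h : 0 < ∫ s in (0:ℝ)..1, -psiIntegrand α 0 s := by
    refine intervalIntegral.intervalIntegral_pos_of_pos_on
      (intervalIntegrable_psiIntegrand hα le_rfl zero_le_one).neg (fun s hs => ?_) zero_lt_one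
    have hq := exp_neg_sq_mul_sq_lt_one hα hs.1
    have hlog : Real.log (1 - Real.exp (-α ^ 2 * s ^ 2)) < 0 :=
      Real.log_neg (by linarith) (by linarith [Real.exp_pos (-α ^ 2 * s ^ 2)])
    have hsqrt : 0 < Real.sqrt (1 - s ^ 2) := Real.sqrt_pos.2 (by nlinarith [hs.1, hs.2])
    simpa [psiIntegrand] using mul_neg_of_neg_of_pos hlog hsqrt
  rw [intervalIntegral.integral_neg, neg_pos] at h
  rw [PsiW_eq]
  exact mul_neg_of_pos_of_neg (by positivity) h

theorem cFun_pos (α : ℝ) : 0 < cFun α := by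
  refine mul_pos (by positivity) ?_
  refine intervalIntegral.intervalIntegral_pos_of_pos_on
    (Continuous.intervalIntegrable (by fun_prop) _ _) (fun s hs => ?_) zero_lt_one
  have hsqrt : 0 < Real.sqrt (1 - s ^ 2) := Real.sqrt_pos.2 (by nlinarith [hs.1, hs.2])
  positivity

theorem mul_le_log_one_sub_mul_exp {q : ℝ} (hq0 : 0 ≤ q) (hq1 : q ≤ 1) (u : ℝ) :
    q * u ≤ Real.log (1 - (1 - Real.exp u) * q) := by
  have h := convexOn_exp.2 (mem_univ 0) (mem_univ u) (sub_nonneg.2 hq1) hq0 (by ring)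
  simp only [smul_eq_mul, mul_zero, zero_add, Real.exp_zero, mul_one] at h
  have h2 : Real.exp (q * u) ≤ 1 - (1 - Real.exp u) * q := by linarith
  exact (Real.le_log_iff_exp_le ((Real.exp_pos _).trans_le h2)).2 h2

theorem cFun_div_two_mul_le_PsiW_exp (α u : ℝ) : cFun α / 2 * u ≤ PsiW α (Real.exp u) := by
  have h : ∫ s in (0:ℝ)..1, Real.exp (-α ^ 2 * s ^ 2) * Real.sqrt (1 - s ^ 2) * u ≤
      ∫ s in (0:ℝ)..1, psiIntegrand α (Real.exp u) s := by
    refine intervalIntegral.integral_mono_on zero_le_one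
      (Continuous.intervalIntegrable (by fun_prop) _ _)
      (intervalIntegrable_psiIntegrand_of_pos (Real.exp_pos u)) fun s _ => ?_
    rw [mul_right_comm]
    refine mul_le_mul_of_nonneg_right ?_ (Real.sqrt_nonneg _)
    exact mul_le_log_one_sub_mul_exp (Real.exp_pos _).le
      (Real.exp_le_one_iff.2 (by nlinarith [sq_nonneg (α * s)])) u
  rw [intervalIntegral.integral_mul_const] at h
  have h2 := mul_le_mul_of_nonneg_left h (show 0 ≤ 2 / π by positivity)
  rw [← PsiW_eq] at h2
  refine le_of_eq_of_le ?_ h2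
  rw [cFun]
  ring

theorem mul_sub_PsiW_exp_le {α x : ℝ} (hα : 0 < α) (hx : 0 < x) (hxc : x ≤ cFun α) (u : ℝ) :
    x / 2 * u - PsiW α (Real.exp u) ≤ -PsiW α 0 := by
  rcases le_total u 0 with hu | hu
  · nlinarith [PsiW_zero_le hα (Real.exp_pos u)]
  · nlinarith [cFun_div_two_mul_le_PsiW_exp α u, PsiW_zero_neg hα]

theorem tendsto_PsiW_exp_atBot {α : ℝ} (hα : 0 < α) :
    Tendsto (fun u : ℝ => PsiW α (Real.exp u)) atBot (nhds (PsiW α 0)) := by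
  simp only [PsiW_eq]
  refine Tendsto.const_mul _ ?_
  refine intervalIntegral.tendsto_integral_filter_of_dominated_convergence _
    (Eventually.of_forall fun u => (measurable_psiIntegrand α _).aestronglyMeasurable) ?_
    (intervalIntegrable_psiIntegrand_bound α) ?_
  · filter_upwards [eventually_le_atBot 0] with u hu
    refine Eventually.of_forall fun s hs => ?_
    rw [uIoc_of_le zero_le_one] at hs
    exact norm_psiIntegrand_le hα hs.1 (Real.exp_pos u).le (Real.exp_le_one_iff.2 hu)
  · refine Eventually.of_forall fun s hs => ?_
    rw [uIoc_of_le zero_le_one] at hs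
    have hq := exp_neg_sq_mul_sq_lt_one hα hs.1
    have hne : 1 - (1 - 0) * Real.exp (-α ^ 2 * s ^ 2) ≠ 0 := by
      rw [sub_zero, one_mul]
      exact (sub_pos.2 hq).ne'
    exact (((Real.tendsto_exp_atBot.const_sub 1).mul_const _).const_sub 1 |>.log hne).mul_const _

theorem tendsto_phiW_nhdsGT_zero {α : ℝ} (hα : 0 < α) :
    Tendsto (phiW α) (nhdsWithin 0 (Set.Ioi 0)) (nhds (-PsiW α 0)) := by
  have hsmall : ∀ᶠ x : ℝ in nhdsWithin 0 (Set.Ioi 0), 0 < x ∧ x ≤ cFun α :=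
    Ioc_mem_nhdsGT (cFun_pos α)
  refine tendsto_order.2 ⟨fun a ha => ?_, fun a ha => ?_⟩
  · obtain ⟨u, hu⟩ := ((tendsto_PsiW_exp_atBot hα).neg.eventually_const_lt ha).exists
    have hlim : Tendsto (fun x : ℝ => x / 2 * u - PsiW α (Real.exp u))
        (nhdsWithin 0 (Set.Ioi 0)) (nhds (-PsiW α (Real.exp u))) := by
      have : Continuous fun x : ℝ => x / 2 * u - PsiW α (Real.exp u) := by fun_prop
      simpa using (this.tendsto 0).mono_left nhdsWithin_le_nhds
    filter_upwards [hsmall, hlim.eventually_const_lt hu] with x hx hax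
    exact hax.trans_le
      (le_ciSup (f := fun u : ℝ => x / 2 * u - PsiW α (Real.exp u))
        ⟨-PsiW α 0, forall_mem_range.2 (mul_sub_PsiW_exp_le hα hx.1 hx.2)⟩ u)
  · filter_upwards [hsmall] with x hx
    exact (ciSup_le (mul_sub_PsiW_exp_le hα hx.1 hx.2)).trans_lt ha

/-- **Left-tail limit of the weak-asymmetry rate function.** For `α > 0`,
`φ_w(x;α) → -Ψ_w(0;α) = -(2/π) ∫_0^1 log(1-e^{-α²s²}) √(1-s²) ds` as `x → 0⁺`, and this
quantity is finite and positive. -/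
theorem phiW_left_tail_limit (α : ℝ) (hα : 0 < α) :
    Tendsto (fun x : ℝ => phiW α x) (nhdsWithin 0 (Set.Ioi 0)) (nhds (-(PsiW α 0))) ∧
    -(PsiW α 0) =
      -((2 / π) * ∫ s in (0:ℝ)..1,
          Real.log (1 - Real.exp (-α ^ 2 * s ^ 2)) * Real.sqrt (1 - s ^ 2)) ∧
    IntervalIntegrable
      (fun s : ℝ => Real.log (1 - Real.exp (-α ^ 2 * s ^ 2)) * Real.sqrt (1 - s ^ 2))
      MeasureTheory.volume 0 1 ∧
    0 < -(PsiW α 0) := by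
  refine ⟨tendsto_phiW_nhdsGT_zero hα, by simp [PsiW], ?_, neg_pos.2 (PsiW_zero_neg hα)⟩
  simpa only [funext (psiIntegrand.eq_1 α 0), sub_zero, one_mul] using
    intervalIntegrable_psiIntegrand hα le_rfl zero_le_one
end
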